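/- arXiv:2308.00934 — 2 statements merged into one kernel-verified Lean document; each statement's English description precedes it below -/
import Mathlib

section
/- Let n be an even positive integer and W a positive integer, and let T_1, …, T_{n-1} be W×W complex matrices. Then the chiral block tridiagonal matrix H is invertible if and only if all the odd-indexed matrices T_1, T_3, …, T_{n-1} are invertible. -/
open Matrix

/-- The chiral block tridiagonal matrix `H` with zero diagonal blocks, subdiagonal blocks
`H_{x+1,x} = -T_x` and superdiagonal blocks `H_{x,x+1} = -T_xᴴ` (blocks indexed by
`x, y ∈ {1, …, n}`, here realized as `Fin n` with `x ↔ x.val + 1`). -/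
def chiralH (n W : ℕ) (T : ℕ → Matrix (Fin W) (Fin W) ℂ) :
    Matrix (Fin n × Fin W) (Fin n × Fin W) ℂ := fun p q =>
  if q.1.val = p.1.val + 1 then (-(T (p.1.val + 1))ᴴ) p.2 q.2
  else if p.1.val = q.1.val + 1 then (-(T (q.1.val + 1))) p.2 q.2
  else 0

/-- A block triangular matrix over `ι × κ`, for an injective order label on `ι`, is invertible
iff all its diagonal blocks are. -/
theorem Matrix.BlockTriangular.isUnit_iff_forall_isUnit_block {ι κ α K : Type*} [Fintype ι]
    [DecidableEq ι] [Fintype κ] [DecidableEq κ] [Nonempty κ] [LinearOrder α]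
    [Field K] {M : Matrix (ι × κ) (ι × κ) K} {b : ι → α} (hb : Function.Injective b)
    (hM : M.BlockTriangular fun p => b p.1) :
    IsUnit M ↔ ∀ x, IsUnit (Matrix.of fun i j => M (x, i) (x, j)) := by
  have key (x : ι) : (M.toSquareBlock (fun p => b p.1) (b x)).det =
      (Matrix.of fun i j => M (x, i) (x, j)).det := by
    let e : κ ≃ {p : ι × κ // b p.1 = b x} :=
      { toFun := fun i => ⟨(x, i), rfl⟩
        invFun := fun p => p.1.2
        left_inv := fun _ => rfl
        right_inv := by
          rintro ⟨⟨y, i⟩, h⟩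
          obtain rfl := hb h
          rfl }
    exact (Matrix.det_submatrix_equiv_self e _).symm
  simp only [Matrix.isUnit_iff_isUnit_det, isUnit_iff_ne_zero, hM.det, Finset.prod_ne_zero_iff,
    Finset.forall_mem_image, Finset.mem_univ, forall_const, Prod.forall, key]

/-- The permutation of `Fin n`, `n` even, which exchanges `2 * k` and `2 * k + 1`. -/
def Fin.swapPairs {n : ℕ} (hn : Even n) : Equiv.Perm (Fin n) :=
  Function.Involutive.toPerm
    (fun x => ⟨if x.val % 2 = 0 then x.val + 1 else x.val - 1, by
      obtain ⟨m, rfl⟩ := hn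
      split_ifs <;> omega⟩)
    (fun x => by
      apply Fin.ext
      dsimp only
      split_ifs <;> omega)

theorem Fin.val_swapPairs {n : ℕ} (hn : Even n) (x : Fin n) :
    (Fin.swapPairs hn x).val = if x.val % 2 = 0 then x.val + 1 else x.val - 1 := rfl

/-- A label on block indices which decreases along even and increases along odd indices. -/
def alternatingLabel (x : ℕ) : ℤ := if x % 2 = 0 then -x else x

theorem alternatingLabel_injective : Function.Injective alternatingLabel := by
  intro x y h
  unfold alternatingLabel at h
  split_ifs at h <;> omega

/-- Exchanging the block columns `2 * k` and `2 * k + 1` makes `chiralH` block triangular. -/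
theorem chiralH_submatrix_swapPairs_blockTriangular (W : ℕ) {n : ℕ} (hn : Even n)
    (T : ℕ → Matrix (Fin W) (Fin W) ℂ) :
    ((chiralH n W T).submatrix (Equiv.refl _)
      ((Fin.swapPairs hn).prodCongr (Equiv.refl _))).BlockTriangular
      fun p => alternatingLabel p.1.val := by
  rintro ⟨x, i⟩ ⟨y, j⟩ h
  have hy := Fin.val_swapPairs hn y
  simp only [alternatingLabel] at h
  change (if (Fin.swapPairs hn y).val = x.val + 1 then _
    else if x.val = (Fin.swapPairs hn y).val + 1 then _ else (0 : ℂ)) = 0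
  rw [if_neg, if_neg] <;> split_ifs at h hy <;> omega

/-- For an even number of blocks `n`, the chiral block tridiagonal matrix is invertible
iff all the odd-indexed hopping matrices `T_1, T_3, …, T_{n-1}` are invertible. -/
theorem chiralH_even_isUnit_iff (W n : ℕ) (hW : 1 ≤ W) (hn : Even n) (hn' : 1 ≤ n)
    (T : ℕ → Matrix (Fin W) (Fin W) ℂ) :
    IsUnit (chiralH n W T) ↔ ∀ k : ℕ, 2 * k + 1 < n → IsUnit (T (2 * k + 1)) := by
  have block (x : Fin n) : IsUnit (Matrix.of fun i j => (chiralH n W T).submatrix (Equiv.refl _)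
      ((Fin.swapPairs hn).prodCongr (Equiv.refl _)) (x, i) (x, j)) ↔
      IsUnit (T (2 * (x.val / 2) + 1)) := by
    rcases Nat.mod_two_eq_zero_or_one x.val with hx | hx
    · have hT : (Matrix.of fun i j => (chiralH n W T).submatrix (Equiv.refl _)
          ((Fin.swapPairs hn).prodCongr (Equiv.refl _)) (x, i) (x, j)) =
          -(T (2 * (x.val / 2) + 1))ᴴ := by
        ext i j
        simp only [Matrix.of_apply, Matrix.submatrix_apply, chiralH, Equiv.prodCongr_apply,
          Prod.map, Equiv.refl_apply, Fin.val_swapPairs, if_pos hx, if_true]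
        rw [show 2 * (x.val / 2) = x.val by omega]
      rw [hT, IsUnit.neg_iff, ← Matrix.star_eq_conjTranspose, isUnit_star]
    · have hT : (Matrix.of fun i j => (chiralH n W T).submatrix (Equiv.refl _)
          ((Fin.swapPairs hn).prodCongr (Equiv.refl _)) (x, i) (x, j)) =
          -T (2 * (x.val / 2) + 1) := by
        ext i j
        simp only [Matrix.of_apply, Matrix.submatrix_apply, chiralH, Equiv.prodCongr_apply,
          Prod.map, Equiv.refl_apply, Fin.val_swapPairs, hx, one_ne_zero, if_false]
        rw [if_neg (by omega), if_pos (by omega),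
          show 2 * (x.val / 2) = x.val - 1 by omega]
      rw [hT, IsUnit.neg_iff]
  have : Nonempty (Fin W) := ⟨⟨0, hW⟩⟩
  rw [← Matrix.isUnit_submatrix_equiv (Equiv.refl _)
      ((Fin.swapPairs hn).prodCongr (Equiv.refl _)),
    Matrix.BlockTriangular.isUnit_iff_forall_isUnit_block
      (alternatingLabel_injective.comp Fin.val_injective)
      (chiralH_submatrix_swapPairs_blockTriangular W hn T)]
  simp only [block]
  constructor
  · intro h k hk
    simpa using h ⟨2 * k, by omega⟩
  · intro h x
    obtain ⟨m, rfl⟩ := hn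
    exact h _ (by omega)
end

section
/- For W ∈ ℕ and k ∈ {1, …, W}, define γ_k(W) := log(1/√W) + (1/2)(log 2 + Ψ((W − k + 1)/2)), where Ψ = (log ∘ Γ)' is the digamma function. Then for each fixed k ∈ ℕ, lim_{W→∞} W · γ_k(W) = −k/2. -/
open Filter

/-- The digamma function `Ψ = (log ∘ Γ)'` on the reals. -/
noncomputable def digamma (x : ℝ) : ℝ :=
  deriv (fun y => Real.log (Real.Gamma y)) x

/-- The `k`-th Lyapunov exponent of a product of i.i.d. `Ginibre(W)` matrices, as given by
Newman's formula: `γ_k(W) = log(1/√W) + (1/2)(log 2 + Ψ((W - k + 1)/2))`. -/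
noncomputable def newmanGamma (k W : ℕ) : ℝ :=
  Real.log (1 / Real.sqrt W) + (1 / 2) * (Real.log 2 + digamma (((W : ℝ) - k + 1) / 2))

/-- The logarithm of the Gamma function is differentiable on the positive reals. -/
lemma differentiableAt_log_Gamma {x : ℝ} (hx : 0 < x) :
    DifferentiableAt ℝ (fun y => Real.log (Real.Gamma y)) x :=
  (Real.differentiableAt_Gamma fun m => by
    have : (0 : ℝ) ≤ m := m.cast_nonneg
    linarith).log (Real.Gamma_pos_of_pos hx).ne'

lemma log_Gamma_add_one {x : ℝ} (hx : 0 < x) :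
    Real.log (Real.Gamma (x + 1)) = Real.log x + Real.log (Real.Gamma x) := by
  rw [Real.Gamma_add_one hx.ne', Real.log_mul hx.ne' (Real.Gamma_pos_of_pos hx).ne']

lemma digamma_add_one {x : ℝ} (hx : 0 < x) : digamma (x + 1) = digamma x + 1 / x := by
  have h : (fun y => Real.log (Real.Gamma (y + 1))) =ᶠ[nhds x]
      fun y => Real.log y + Real.log (Real.Gamma y) := by
    filter_upwards [lt_mem_nhds hx] with y hy using log_Gamma_add_one hy
  have hd := h.deriv_eq
  rw [deriv_comp_add_const (fun y => Real.log (Real.Gamma y)),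
    deriv_fun_add (Real.differentiableAt_log hx.ne') (differentiableAt_log_Gamma hx),
    Real.deriv_log] at hd
  rw [digamma, digamma, hd]
  ring

lemma digamma_le_log {x : ℝ} (hx : 0 < x) : digamma x ≤ Real.log x := by
  have h := Real.convexOn_log_Gamma.deriv_le_slope (x := x) (y := x + 1) hx
    (by simp only [Set.mem_Ioi]; linarith) (by linarith) (differentiableAt_log_Gamma hx)
  simpa [slope_def_field, log_Gamma_add_one hx, digamma, Function.comp_def] using h

lemma log_sub_inv_le_digamma {x : ℝ} (hx : 0 < x) : Real.log x - 1 / x ≤ digamma x := by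
  have hx1 : 0 < x + 1 := by linarith
  have h := Real.convexOn_log_Gamma.slope_le_deriv (x := x) (y := x + 1) hx
    hx1 (by linarith) (differentiableAt_log_Gamma hx1)
  have hlog : Real.log x ≤ digamma (x + 1) := by
    simpa [slope_def_field, log_Gamma_add_one hx, digamma, Function.comp_def] using h
  rw [digamma_add_one hx] at hlog
  linarith

/-- The trapezoidal rule overestimates `∫ 1/t` over `[x, x + 1]`. -/
lemma log_add_one_sub_log_le {x : ℝ} (hx : 0 < x) :
    Real.log (x + 1) - Real.log x ≤ (1 / x + 1 / (x + 1)) / 2 := by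
  have hx1 : 0 < x + 1 := by linarith
  have hy : 0 < (x + 1) / x := by positivity
  have h : Real.log ((x + 1) / x) ≤ Real.sinh (Real.log ((x + 1) / x)) :=
    Real.self_le_sinh_iff.2 (Real.log_nonneg (by rw [le_div_iff₀ hx]; linarith))
  rw [Real.sinh_log hy, Real.log_div hx1.ne' hx.ne'] at h
  refine h.trans_eq ?_
  field_simp
  ring

lemma le_log_add_one_sub_log {x : ℝ} (hx : 0 < x) :
    (1 / x + 1 / (x + 1)) / 2 - (1 / x ^ 2 - 1 / (x + 1) ^ 2) ≤
      Real.log (x + 1) - Real.log x := by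
  have hx1 : 0 < x + 1 := by linarith
  have h := Real.le_log_one_add_of_nonneg (x := 1 / x) (by positivity)
  rw [show 1 + 1 / x = (x + 1) / x by field_simp, Real.log_div hx1.ne' hx.ne'] at h
  refine le_trans ?_ h
  rw [← sub_nonneg]
  have : 2 * (1 / x) / (1 / x + 2) - ((1 / x + 1 / (x + 1)) / 2 - (1 / x ^ 2 - 1 / (x + 1) ^ 2))
      = (7 * x ^ 2 + 7 * x + 2) / (2 * x ^ 2 * (x + 1) ^ 2 * (2 * x + 1)) := by
    field_simp
    ring
  rw [this]
  positivity

lemma tendsto_digamma_sub_log : Tendsto (fun x => digamma x - Real.log x) atTop (nhds 0) := by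
  refine tendsto_of_tendsto_of_tendsto_of_le_of_le' (g := fun x : ℝ => -(1 / x)) (h := fun _ => 0)
    (by simpa using (tendsto_inv_atTop_zero (𝕜 := ℝ)).neg) tendsto_const_nhds ?_ ?_
  · filter_upwards [eventually_gt_atTop 0] with x hx
    linarith [log_sub_inv_le_digamma hx]
  · filter_upwards [eventually_gt_atTop 0] with x hx
    linarith [digamma_le_log hx]

/-- A function tending to `0` at infinity which does not decrease under unit shifts
is nonpositive. -/
lemma nonpos_of_le_add_one {f : ℝ → ℝ} (hf : ∀ x, 0 < x → f x ≤ f (x + 1))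
    (hlim : Tendsto f atTop (nhds 0)) {x : ℝ} (hx : 0 < x) : f x ≤ 0 := by
  have hmono : Monotone fun n : ℕ => f (x + n) := monotone_nat_of_le_succ fun n => by
    have := hf (x + n) (by positivity)
    rwa [add_assoc, ← Nat.cast_succ] at this
  have ht : Tendsto (fun n : ℕ => f (x + n)) atTop (nhds 0) :=
    hlim.comp (tendsto_atTop_add_const_left _ x tendsto_natCast_atTop_atTop)
  simpa using hmono.ge_of_tendsto ht 0

lemma digamma_le_log_sub {x : ℝ} (hx : 0 < x) : digamma x ≤ Real.log x - 1 / (2 * x) := by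
  have h := nonpos_of_le_add_one (f := fun x => digamma x - Real.log x + 2⁻¹ * x⁻¹)
    (fun y hy => by
      have h1 := log_add_one_sub_log_le hy
      have h2 := digamma_add_one hy
      simp only [one_div] at h1 h2
      linarith)
    (by simpa using tendsto_digamma_sub_log.add (tendsto_inv_atTop_zero.const_mul (2⁻¹ : ℝ))) hx
  rw [one_div, mul_inv]
  linarith

lemma log_sub_le_digamma {x : ℝ} (hx : 0 < x) :
    Real.log x - 1 / (2 * x) - 1 / x ^ 2 ≤ digamma x := by
  have hsq : Tendsto (fun x : ℝ => (x ^ 2)⁻¹) atTop (nhds 0) :=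
    (tendsto_pow_atTop two_ne_zero).inv_tendsto_atTop
  have h := nonpos_of_le_add_one
    (f := fun x => -(digamma x - Real.log x + 2⁻¹ * x⁻¹ + (x ^ 2)⁻¹))
    (fun y hy => by
      have h1 := le_log_add_one_sub_log hy
      have h2 := digamma_add_one hy
      simp only [one_div] at h1 h2
      linarith)
    (by simpa using
      ((tendsto_digamma_sub_log.add (tendsto_inv_atTop_zero.const_mul (2⁻¹ : ℝ))).add hsq).neg) hx
  rw [one_div, one_div, mul_inv]
  linarith

/-- `Ψ(x) = log x - 1 / (2x) + o(1 / x)` as `x → ∞`. -/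
lemma tendsto_mul_digamma_sub_log :
    Tendsto (fun x => x * (digamma x - Real.log x)) atTop (nhds (-(1 / 2))) := by
  refine tendsto_of_tendsto_of_tendsto_of_le_of_le' (g := fun x : ℝ => -(1 / 2) - x⁻¹)
    (h := fun _ => -(1 / 2))
    (by simpa using (tendsto_inv_atTop_zero (𝕜 := ℝ)).const_sub (-2⁻¹))
    tendsto_const_nhds ?_ ?_
  · filter_upwards [eventually_gt_atTop 0] with x hx
    calc -(1 / 2) - x⁻¹ = x * (-(1 / (2 * x)) - 1 / x ^ 2) := by field_simp
      _ ≤ _ := mul_le_mul_of_nonneg_left (by linarith [log_sub_le_digamma hx]) hx.le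
  · filter_upwards [eventually_gt_atTop 0] with x hx
    calc x * (digamma x - Real.log x) ≤ x * (-(1 / (2 * x))) :=
          mul_le_mul_of_nonneg_left (by linarith [digamma_le_log_sub hx]) hx.le
      _ = -(1 / 2) := by field_simp

/-- Large-`W` asymptotics of Newman's Lyapunov exponents: for each fixed `k`,
`W · γ_k(W) → -k/2` as `W → ∞`. -/
theorem newmanGamma_asymptotics (k : ℕ) (hk : 1 ≤ k) :
    Tendsto (fun W : ℕ => (W : ℝ) * newmanGamma k W) atTop (nhds (-(k : ℝ) / 2)) := by
  have hcast : Tendsto (fun W : ℕ => (W : ℝ)) atTop atTop := tendsto_natCast_atTop_atTop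
  have hlog := ((Real.tendsto_mul_log_one_add_div_atTop (1 - (k : ℝ))).comp hcast).const_mul (1 / 2)
  have harg : Tendsto (fun W : ℕ => ((W : ℝ) - k + 1) / 2) atTop atTop := by
    refine Tendsto.atTop_div_const two_pos ?_
    simpa only [sub_eq_add_neg, add_assoc] using
      tendsto_atTop_add_const_right _ (-(k : ℝ) + 1) hcast
  have hdigamma := tendsto_mul_digamma_sub_log.comp harg
  have hratio : Tendsto (fun W : ℕ => 1 + (k - 1) / 2 * (((W : ℝ) - k + 1) / 2)⁻¹)
      atTop (nhds 1) := by
    simpa using (harg.inv_tendsto_atTop.const_mul (((k : ℝ) - 1) / 2)).const_add 1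
  have hsum := hlog.add (hratio.mul hdigamma)
  rw [show 1 / 2 * (1 - (k : ℝ)) + 1 * -(1 / 2) = -(k : ℝ) / 2 by ring] at hsum
  refine hsum.congr' ?_
  filter_upwards [harg.eventually_gt_atTop 0, hcast.eventually_gt_atTop 0] with W hx hW
  have hy : 0 < (W : ℝ) - k + 1 := by linarith
  simp only [Function.comp_apply, newmanGamma]
  rw [show 1 + (1 - (k : ℝ)) / W = ((W : ℝ) - k + 1) / W by field_simp; ring,
    Real.log_div hy.ne' hW.ne', Real.log_div hy.ne' two_ne_zero, one_div (√_), Real.log_inv,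
    Real.log_sqrt hW.le]
  field_simp
  ring
end
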